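/- Let A ∈ M_n be a complex n×n matrix and let 2 ≤ k ≤ n. Then Λ_k(A) = ⋂{W(A + 2e^{iξ}‖A‖P) : ξ ∈ [0,2π), P ∈ P_{k−1}}, where the intersection is over all ξ ∈ [0,2π) and all rank-(k−1) orthogonal projections P ∈ M_n. -/

import Mathlib

noncomputable section

open scoped InnerProductSpace
open Complex

variable {H : Type*} [NormedAddCommGroup H] [InnerProductSpace ℂ H] [CompleteSpace H]

/-- `P` is an orthogonal projection: self-adjoint and idempotent. -/
def IsOrthProj (P : H →L[ℂ] H) : Prop :=
  IsSelfAdjoint P ∧ P ∘L P = P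

/-- The rank of a bounded operator, as a cardinal. -/
def opRank (F : H →L[ℂ] H) : Cardinal :=
  Module.rank ℂ (LinearMap.range (F : H →ₗ[ℂ] H))

/-- The rank-`k` numerical range `Λ_k(A)`. -/
def rankKRange (k : ℕ) (A : H →L[ℂ] H) : Set ℂ :=
  { lam | ∃ P : H →L[ℂ] H, IsOrthProj P ∧ opRank P = k ∧ P ∘L A ∘L P = lam • P }

/-- The classical numerical range `W(A)`. -/
def numRange (A : H →L[ℂ] H) : Set ℂ :=
  { z | ∃ x : H, ‖x‖ = 1 ∧ ⟪x, A x⟫_ℂ = z }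

/-- `λ_k(T)`: the supremum over `k`-dimensional compressions of the `k`-th largest
eigenvalue of the compression (Courant–Fischer form: sup over `k`-dimensional
subspaces of the infimum of the Rayleigh quotient). -/
def lambdaSA (k : ℕ) (T : H →L[ℂ] H) : ℝ :=
  sSup { t : ℝ | ∃ V : Submodule ℂ H, Module.finrank ℂ V = k ∧
    ∀ x ∈ V, ‖x‖ = 1 → t ≤ (⟪x, T x⟫_ℂ).re }

/-- The real part `(T + T*)/2` of an operator. -/
def reOp (T : H →L[ℂ] H) : H →L[ℂ] H :=
  (2 : ℂ)⁻¹ • (T + ContinuousLinearMap.adjoint T)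

/-- The set `Ω_k(A)`. -/
def omegaK (k : ℕ) (A : H →L[ℂ] H) : Set ℂ :=
  { μ | ∀ ξ ∈ Set.Ico (0 : ℝ) (2 * Real.pi),
      (Complex.exp (ξ * Complex.I) * μ).re ≤ lambdaSA k (reOp (Complex.exp (ξ * Complex.I) • A)) }


def walkS (ε : ℕ → ℤ) (j : ℕ) : ℤ := ∑ i ∈ Finset.range j, ε i

def walkL (ε : ℕ → ℤ) (i : ℕ) : ℤ := max (walkS ε i) (walkS ε (i+1))

lemma walkS_succ (ε : ℕ → ℤ) (j : ℕ) : walkS ε (j+1) = walkS ε j + ε j := by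
  simp [walkS, Finset.sum_range_succ]

lemma walk_sign (ε : ℕ → ℤ) (hε : ∀ i, ε i = 1 ∨ ε i = -1) (m : ℕ) (L : ℤ) (hL : L ≤ walkS ε m)
    (d : ℕ) : ∀ j, j + d = m →
    (-1 : ℝ) ^ (((Finset.Ico j m).filter (fun i => walkL ε i = L)).card)
      = if L ≤ walkS ε j then 1 else -1 := by
  induction d with
  | zero => intro j hj; simp at hj; subst hj; simp [hL]
  | succ d ih =>
    intro j hj
    have h1 := ih (j+1) (by omega)
    rw [← Finset.insert_Ico_add_one_left_eq_Ico (show j < m by omega), Finset.filter_insert]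
    have hs := walkS_succ ε j
    have hl : walkL ε j = max (walkS ε j) (walkS ε (j+1)) := rfl
    by_cases hc : walkL ε j = L
    · rw [if_pos hc, Finset.card_insert_of_notMem (by simp), pow_succ, h1]
      rcases hε j with h | h <;> rw [h] at hs
      · rw [if_pos (by omega), if_neg (by omega)]; norm_num
      · rw [if_neg (by omega), if_pos (by omega)]; norm_num
    · rw [if_neg hc, h1]
      congr 1
      rcases hε j with h | h <;> rw [h] at hs <;> apply propext <;> omega

lemma walk_sum (ε : ℕ → ℤ) (hε : ∀ i, ε i = 1 ∨ ε i = -1) (L : ℤ) (hL : 1 ≤ L) (m : ℕ) :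
    (∑ i ∈ (Finset.range m).filter (fun i => walkL ε i = L), ε i)
      = if L ≤ walkS ε m then 1 else 0 := by
  induction m with
  | zero => simp [walkS]; omega
  | succ m ih =>
    rw [Finset.range_add_one, Finset.filter_insert]
    have hs := walkS_succ ε m
    have hl : walkL ε m = max (walkS ε m) (walkS ε (m+1)) := rfl
    by_cases hc : walkL ε m = L
    · rw [if_pos hc, Finset.sum_insert (by simp), ih]
      rcases hε m with h | h <;> rw [h] at hs ⊢
      · rw [if_pos (show L ≤ walkS ε (m+1) by omega), if_neg (by omega)]; norm_num
      · rw [if_neg (show ¬ L ≤ walkS ε (m+1) by omega), if_pos (by omega)]; norm_num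
    · rw [if_neg hc, ih]
      congr 1
      rcases hε m with h | h <;> rw [h] at hs <;> apply propext <;> omega

lemma walk_const (ε : ℕ → ℤ) (c : ℤ) (i : ℕ) : ∀ d, (∀ l, i ≤ l → l < i + d → ε l = c) →
    walkS ε (i+d) = walkS ε i + d * c := by
  intro d
  induction d with
  | zero => simp
  | succ d ih =>
    intro h
    rw [← add_assoc, walkS_succ, ih (fun l h1 h2 => h l h1 (by omega)), h (i+d) (by omega) (by omega)]
    push_cast; ring

lemma walk_main (m : ℕ) (ε : ℕ → ℤ) (hε : ∀ i, ε i = 1 ∨ ε i = -1) (t : ℕ → ℝ)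
    (ht : ∀ i j, i ≤ j → j < m → t i ≤ t j)
    (hte : ∀ i j, i < m → j < m → t i = t j → ε i = ε j)
    (h0 : ∀ j ≤ m, 0 ≤ walkS ε j) (h1 : ∀ j ≤ m, walkS ε j ≤ walkS ε m) :
    ∀ j < m,
      0 < (ε j : ℝ) * ∏ i ∈ ((Finset.range m).filter (fun i => walkL ε i = walkL ε j)).erase j, (t j - t i)
      ∧ ((Finset.range m).filter (fun i => walkL ε i = walkL ε j)).card
        = 2 * ((Finset.range m).filter (fun i => walkL ε i = walkL ε j ∧ ε i = -1)).card + 1 := by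
  -- strictness
  have hst : ∀ i j, i < j → j < m → walkL ε i = walkL ε j → t i < t j := by
    intro i j hij hj hl
    refine lt_of_le_of_ne (ht i j hij.le hj) (fun he => ?_)
    have hc : ∀ l, i ≤ l → l < i + (j - i + 1) → ε l = ε i := by
      intro l hl1 hl2
      refine hte l i (by omega) (by omega) (le_antisymm ?_ (ht _ _ hl1 (by omega)))
      rw [he]; exact ht _ _ (by omega) hj
    have e1 := walk_const ε (ε i) i (j - i + 1) hc
    have e2 := walk_const ε (ε i) i (j - i) (fun l a b => hc l a (by omega))
    have e3 := walkS_succ ε i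
    rw [show i + (j - i + 1) = j + 1 by omega] at e1
    rw [show i + (j - i) = j by omega] at e2
    have hli : walkL ε i = max (walkS ε i) (walkS ε (i+1)) := rfl
    have hlj : walkL ε j = max (walkS ε j) (walkS ε (j+1)) := rfl
    push_cast [hij.le] at e1 e2
    rcases hε i with h | h <;> rw [h] at e1 e2 e3 <;> omega
  intro j hj
  have hlj : walkL ε j = max (walkS ε j) (walkS ε (j+1)) := rfl
  have hsj := walkS_succ ε j
  have hLm : walkL ε j ≤ walkS ε m := by
    rw [hlj]; exact max_le (h1 _ hj.le) (h1 _ hj)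
  have hL1 : 1 ≤ walkL ε j := by
    have := h0 j hj.le
    have := h0 (j+1) hj
    rcases hε j with h | h <;> omega
  constructor
  · have hsg := walk_sign ε hε m (walkL ε j) hLm (m - (j+1)) (j+1) (by omega)
    have hsplit : ((Finset.range m).filter (fun i => walkL ε i = walkL ε j)).erase j
        = ((Finset.range j).filter (fun i => walkL ε i = walkL ε j)) ∪
          ((Finset.Ico (j+1) m).filter (fun i => walkL ε i = walkL ε j)) := by
      ext i; simp only [Finset.mem_erase, Finset.mem_filter, Finset.mem_range, Finset.mem_union, Finset.mem_Ico]
      constructor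
      · rintro ⟨a, b, c⟩
        rcases lt_or_gt_of_ne a with h | h
        · exact Or.inl ⟨h, c⟩
        · exact Or.inr ⟨⟨h, b⟩, c⟩
      · rintro (⟨a, b⟩ | ⟨⟨a, b⟩, c⟩)
        · exact ⟨by omega, by omega, b⟩
        · exact ⟨by omega, by omega, c⟩
    rw [hsplit, Finset.prod_union]
    · have hp1 : 0 < ∏ i ∈ ((Finset.range j).filter (fun i => walkL ε i = walkL ε j)), (t j - t i) := by
        apply Finset.prod_pos
        intro i hi
        simp only [Finset.mem_filter, Finset.mem_range] at hi
        have := hst i j hi.1 hj hi.2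
        linarith
      have hp2 : 0 < ∏ i ∈ ((Finset.Ico (j+1) m).filter (fun i => walkL ε i = walkL ε j)), (t i - t j) := by
        apply Finset.prod_pos
        intro i hi
        simp only [Finset.mem_filter, Finset.mem_Ico] at hi
        have := hst j i (by omega) hi.1.2 hi.2.symm
        linarith
      have hp3 : ∏ i ∈ ((Finset.Ico (j+1) m).filter (fun i => walkL ε i = walkL ε j)), (t j - t i)
          = (ε j : ℝ) * ∏ i ∈ ((Finset.Ico (j+1) m).filter (fun i => walkL ε i = walkL ε j)), (t i - t j) := by
        have : ∀ i ∈ ((Finset.Ico (j+1) m).filter (fun i => walkL ε i = walkL ε j)), t j - t i = (-1) * (t i - t j) := by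
          intros; ring
        rw [Finset.prod_congr rfl this, Finset.prod_mul_distrib, Finset.prod_const, hsg]
        congr 1
        rcases hε j with h | h
        · rw [if_pos (by omega), h]; simp
        · rw [if_neg (by omega), h]; simp
      rw [hp3]
      have : (ε j : ℝ) * (ε j : ℝ) = 1 := by rcases hε j with h | h <;> simp [h]
      calc _ < _ := mul_pos hp1 hp2
        _ = ((ε j : ℝ) * (ε j : ℝ)) * _ := by rw [this, one_mul]
        _ = _ := by ring
    · rw [Finset.disjoint_left]
      intro i hi hi2
      simp only [Finset.mem_filter, Finset.mem_range, Finset.mem_Ico] at hi hi2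
      omega
  · have hs := walk_sum ε hε (walkL ε j) hL1 m
    rw [if_pos hLm] at hs
    have : ∀ i ∈ (Finset.range m).filter (fun i => walkL ε i = walkL ε j), ε i = 1 - 2 * (if ε i = -1 then 1 else 0) := by
      intro i _
      rcases hε i with h | h <;> simp [h]
    rw [Finset.sum_congr rfl this, Finset.sum_sub_distrib, ← Finset.mul_sum, Finset.sum_boole, Finset.filter_filter] at hs
    simp at hs
    omega

lemma walk_bounds (m : ℕ) (ε : ℕ → ℤ) (hε : ∀ i, ε i = 1 ∨ ε i = -1) (t : ℕ → ℝ)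
    (ht : ∀ i j, i ≤ j → j < m → t i ≤ t j)
    (hte : ∀ i j, i < m → j < m → t i = t j → ε i = ε j)
    (hpre : ∀ τ : ℝ, (∀ i < m, t i ≠ τ) →
      0 ≤ ∑ i ∈ (Finset.range m).filter (fun i => t i < τ), ε i)
    (hsuf : ∀ τ : ℝ, (∀ i < m, t i ≠ τ) →
      0 ≤ ∑ i ∈ (Finset.range m).filter (fun i => τ < t i), ε i) :
    (∀ j ≤ m, 0 ≤ walkS ε j) ∧ (∀ j ≤ m, walkS ε j ≤ walkS ε m) := by
  have hbr : ∀ j ≤ m, (j = 0 ∨ j = m ∨ (0 < j ∧ j < m ∧ t (j-1) < t j)) →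
      0 ≤ walkS ε j ∧ walkS ε j ≤ walkS ε m := by
    intro j hj hc
    have key : ∃ τ, (∀ i < j, t i < τ) ∧ (∀ i, j ≤ i → i < m → τ < t i) := by
      rcases Nat.eq_zero_or_pos j with h0 | h0
      · subst h0
        refine ⟨t 0 - 1, by simp, fun i _ hi => ?_⟩
        have := ht 0 i (by omega) hi
        linarith
      · rcases hj.lt_or_eq with h1 | h1
        · have h2 : t (j-1) < t j := by
            rcases hc with h | h | h
            · omega
            · omega
            · exact h.2.2
          refine ⟨(t (j-1) + t j)/2, fun i hi => ?_, fun i hi hi2 => ?_⟩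
          · have := ht i (j-1) (by omega) (by omega); linarith
          · have := ht j i hi hi2; linarith
        · refine ⟨t (j-1) + 1, fun i hi => ?_, fun i hi hi2 => by omega⟩
          have := ht i (j-1) (by omega) (by omega); linarith
    obtain ⟨τ, a, b⟩ := key
    have hg : ∀ i < m, t i ≠ τ := by
      intro i hi
      rcases lt_or_ge i j with h | h
      · exact (a i h).ne
      · exact (b i h hi).ne'
    have e1 : (Finset.range m).filter (fun i => t i < τ) = Finset.range j := by
      ext i; simp only [Finset.mem_filter, Finset.mem_range]
      constructor
      · rintro ⟨h, h'⟩
        by_contra hn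
        exact absurd (b i (by omega) h) (by linarith)
      · intro h; exact ⟨by omega, a i h⟩
    have e2 : (Finset.range m).filter (fun i => τ < t i) = Finset.Ico j m := by
      ext i; simp only [Finset.mem_filter, Finset.mem_range, Finset.mem_Ico]
      constructor
      · rintro ⟨h, h'⟩
        refine ⟨?_, h⟩
        by_contra hn
        exact absurd (a i (by omega)) (by linarith)
      · rintro ⟨h, h'⟩; exact ⟨by omega, b i h h'⟩
    have f1 := hpre τ hg
    have f2 := hsuf τ hg
    rw [e1] at f1
    rw [e2] at f2
    refine ⟨f1, ?_⟩
    have := Finset.sum_range_add_sum_Ico ε hj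
    unfold walkS; linarith
  have hnb : ∀ j ≤ m, ¬ (j = 0 ∨ j = m ∨ (0 < j ∧ j < m ∧ t (j-1) < t j)) →
      0 < j ∧ j < m ∧ ε (j-1) = ε j := by
    intro j hj hn
    push Not at hn
    obtain ⟨n1, n2, n3⟩ := hn
    refine ⟨by omega, by omega, hte _ _ (by omega) (by omega) (le_antisymm (ht _ _ (by omega) (by omega)) (n3 (by omega) (by omega)))⟩
  constructor
  · obtain ⟨j0, hj0, hmin⟩ := Finset.exists_min_image (Finset.range (m+1)) (walkS ε) ⟨0, by simp⟩
    simp only [Finset.mem_range] at hj0 hmin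
    have : 0 ≤ walkS ε j0 := by
      by_cases hc : (j0 = 0 ∨ j0 = m ∨ (0 < j0 ∧ j0 < m ∧ t (j0-1) < t j0))
      · exact (hbr j0 (by omega) hc).1
      · obtain ⟨a, b, c⟩ := hnb j0 (by omega) hc
        have e1 := walkS_succ ε j0
        have e2 := walkS_succ ε (j0-1)
        rw [show j0 - 1 + 1 = j0 by omega] at e2
        have := hmin (j0-1) (by omega)
        have := hmin (j0+1) (by omega)
        rcases hε j0 with h | h <;> omega
    intro j hj
    exact this.trans (hmin j (by omega))
  · obtain ⟨j0, hj0, hmin⟩ := Finset.exists_max_image (Finset.range (m+1)) (walkS ε) ⟨0, by simp⟩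
    simp only [Finset.mem_range] at hj0 hmin
    have : walkS ε j0 ≤ walkS ε m := by
      by_cases hc : (j0 = 0 ∨ j0 = m ∨ (0 < j0 ∧ j0 < m ∧ t (j0-1) < t j0))
      · exact (hbr j0 (by omega) hc).2
      · obtain ⟨a, b, c⟩ := hnb j0 (by omega) hc
        have e1 := walkS_succ ε j0
        have e2 := walkS_succ ε (j0-1)
        rw [show j0 - 1 + 1 = j0 by omega] at e2
        have := hmin (j0-1) (by omega)
        have := hmin (j0+1) (by omega)
        rcases hε j0 with h | h <;> omega
    intro j hj
    exact (hmin j (by omega)).trans this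

lemma level_fin (m : ℕ) (ε : Fin m → ℤ) (hε : ∀ i, ε i = 1 ∨ ε i = -1) (t : Fin m → ℝ)
    (hte : ∀ i j, t i = t j → ε i = ε j)
    (hpre : ∀ τ : ℝ, (∀ i, t i ≠ τ) →
      0 ≤ ∑ i ∈ Finset.univ.filter (fun i => t i < τ), ε i)
    (hsuf : ∀ τ : ℝ, (∀ i, t i ≠ τ) →
      0 ≤ ∑ i ∈ Finset.univ.filter (fun i => τ < t i), ε i) :
    ∃ l : Fin m → ℤ, ∀ j,
      0 < (ε j : ℝ) * ∏ i ∈ (Finset.univ.filter (fun i => l i = l j)).erase j, (t j - t i)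
      ∧ (Finset.univ.filter (fun i => l i = l j)).card
        = 2 * (Finset.univ.filter (fun i => l i = l j ∧ ε i = -1)).card + 1 := by
  set σ := Tuple.sort t with hσ
  have hmono : Monotone (t ∘ σ) := Tuple.monotone_sort t
  let g : Fin m → ℕ := fun i => (σ.symm i : ℕ)
  have gm : ∀ i, g i < m := fun i => (σ.symm i).2
  have ginj : Function.Injective g := fun i j h => σ.symm.injective (Fin.ext h)
  have gsurj : ∀ a < m, ∃ i, g i = a := fun a ha => ⟨σ ⟨a, ha⟩, by simp [g]⟩
  let ε' : ℕ → ℤ := fun i => if h : i < m then ε (σ ⟨i, h⟩) else 1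
  let t' : ℕ → ℝ := fun i => if h : i < m then t (σ ⟨i, h⟩) else 0
  have eg : ∀ i, ε' (g i) = ε i := by intro i; simp [ε', g]
  have tg : ∀ i, t' (g i) = t i := by intro i; simp [t', g]
  have hε' : ∀ i, ε' i = 1 ∨ ε' i = -1 := by
    intro i; by_cases h : i < m
    · simp only [ε', h, dif_pos]; exact hε _
    · simp [ε', h]
  have filt : ∀ (p : ℕ → Prop) [DecidablePred p], (Finset.range m).filter p
      = (Finset.univ.filter (fun i => p (g i))).image g := by
    intro p _
    ext a; simp only [Finset.mem_filter, Finset.mem_range, Finset.mem_image, Finset.mem_univ, true_and]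
    constructor
    · rintro ⟨h, hp⟩; obtain ⟨i, rfl⟩ := gsurj a h; exact ⟨i, hp, rfl⟩
    · rintro ⟨i, hp, rfl⟩; exact ⟨gm i, hp⟩
  have ht' : ∀ i j, i ≤ j → j < m → t' i ≤ t' j := by
    intro i j hij hj
    have hi : i < m := by omega
    simp only [t', hi, hj, dif_pos]
    exact hmono (show (⟨i, hi⟩ : Fin m) ≤ ⟨j, hj⟩ from hij)
  have hte' : ∀ i j, i < m → j < m → t' i = t' j → ε' i = ε' j := by
    intro i j hi hj
    obtain ⟨a, rfl⟩ := gsurj i hi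
    obtain ⟨b, rfl⟩ := gsurj j hj
    rw [tg, tg, eg, eg]; exact hte a b
  obtain ⟨b0, b1⟩ := walk_bounds m ε' hε' t' ht' hte' (by
      intro τ h
      rw [filt, Finset.sum_image (fun _ _ _ _ h => ginj h)]
      simp only [tg, eg]
      exact hpre τ (fun i => by rw [← tg]; exact h _ (gm i))) (by
      intro τ h
      rw [filt, Finset.sum_image (fun _ _ _ _ h => ginj h)]
      simp only [tg, eg]
      exact hsuf τ (fun i => by rw [← tg]; exact h _ (gm i)))
  refine ⟨fun i => walkL ε' (g i), fun j => ?_⟩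
  have := walk_main m ε' hε' t' ht' hte' b0 b1 (g j) (gm j)
  rw [filt, filt, Finset.card_image_of_injective _ ginj, Finset.card_image_of_injective _ ginj,
    ← Finset.image_erase ginj, Finset.prod_image (fun _ _ _ _ h => ginj h)] at this
  simpa only [tg, eg] using this

open Complex in
lemma exists_generic (m : ℕ) (d : Fin m → ℂ) (hd : ∀ j, d j ≠ 0) :
    ∃ z : ℂ, ∀ j, (z * d j).re ≠ 0 := by
  obtain ⟨s, hs⟩ := Infinite.exists_notMem_finset (Finset.univ.image (fun j => (d j).re / (d j).im))
  refine ⟨1 + s * I, fun j h => ?_⟩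
  have e : ((1 + s * I) * d j).re = (d j).re - s * (d j).im := by simp [add_mul, mul_re]; ring
  rw [e] at h
  by_cases hi : (d j).im = 0
  · apply hd j
    rw [hi] at h
    exact Complex.ext (by simpa using h) hi
  · apply hs
    simp only [Finset.mem_image, Finset.mem_univ, true_and]
    refine ⟨j, ?_⟩
    field_simp
    linarith

open Complex in
lemma diag_iso (m k : ℕ) (d : Fin m → ℂ) (hd : ∀ j, d j ≠ 0)
    (hopp : ∀ i j, ∀ s : ℝ, 0 < s → d i ≠ -(s : ℂ) * d j)
    (hC : ∀ z : ℂ, z ≠ 0 → (Finset.univ.filter (fun j => (z * d j).re < 0)).card + k ≤ m) :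
    ∃ (J : Finset (Fin m)) (x : Fin m → Fin m → ℂ), k ≤ J.card ∧
      (∀ a ∈ J, ∀ b ∈ J, b ≠ a → x a b = 0) ∧ (∀ a ∈ J, x a a ≠ 0) ∧
      ∀ a ∈ J, ∀ b ∈ J, ∑ j, (starRingEnd ℂ) (x a j) * x b j * d j = 0 := by
  rcases Nat.eq_zero_or_pos m with hm | hm
  · subst hm
    have := hC 1 one_ne_zero
    refine ⟨∅, fun _ _ => 0, by simp at this; simp [this], by simp, by simp, by simp⟩
  let c : ℂ → ℕ := fun z => (Finset.univ.filter (fun j => 0 < (z * d j).re)).card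
  have hex : ∃ n, ∃ z, (∀ j, (z * d j).re ≠ 0) ∧ c z = n := by
    obtain ⟨z, hz⟩ := exists_generic m d hd
    exact ⟨c z, z, hz, rfl⟩
  classical
  obtain ⟨z0, hz0, hcz⟩ := Nat.find_spec hex
  have hmin : ∀ z, (∀ j, (z * d j).re ≠ 0) → c z0 ≤ c z := by
    intro z hz; rw [hcz]; exact Nat.find_min' hex ⟨z, hz, rfl⟩
  clear hcz
  have hz00 : z0 ≠ 0 := by
    rintro rfl; exact hz0 ⟨0, hm⟩ (by simp)
  set u : Fin m → ℝ := fun j => (z0 * d j).re with hu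
  set t : Fin m → ℝ := fun j => (z0 * d j).im / u j with ht
  have hu0 : ∀ j, u j ≠ 0 := hz0
  have hw : ∀ j, z0 * d j = (u j : ℂ) * (1 + t j * I) := by
    intro j
    apply Complex.ext
    · simp [hu]
    · have := hu0 j
      simp [ht]
      field_simp
  set ε : Fin m → ℤ := fun j => if 0 < u j then -1 else 1 with hεd
  have hε : ∀ i, ε i = 1 ∨ ε i = -1 := by
    intro i; simp only [hεd]; split_ifs <;> simp
  have hte : ∀ i j, t i = t j → ε i = ε j := by
    intro i j h
    by_contra hne
    have hneg : 0 < -(u i / u j) := by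
      have := hu0 i
      have := hu0 j
      simp only [hεd] at hne
      rw [Left.neg_pos_iff]
      split_ifs at hne with h1 h2 h2
      · exact absurd rfl hne
      · exact div_neg_of_pos_of_neg h1 (lt_of_le_of_ne (not_lt.1 h2) (hu0 j))
      · exact div_neg_of_neg_of_pos (lt_of_le_of_ne (not_lt.1 h1) (hu0 i)) h2
      · exact absurd rfl hne
    apply hopp i j _ hneg
    apply mul_left_cancel₀ hz00
    rw [mul_left_comm, hw, hw, h]
    have : (u j : ℂ) ≠ 0 := by exact_mod_cast hu0 j
    push_cast
    field_simp
  have hcard : ∀ z, (c z : ℤ) = ∑ j, if 0 < (z * d j).re then 1 else 0 := by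
    intro z; simp [c]
  have hpre : ∀ τ : ℝ, (∀ i, t i ≠ τ) →
      0 ≤ ∑ i ∈ Finset.univ.filter (fun i => t i < τ), ε i := by
    intro τ hτ
    have hre : ∀ j, (z0 * (-τ - I) * d j).re = u j * (t j - τ) := by
      intro j
      rw [mul_right_comm, hw]; simp; ring
    have h1 := hmin (z0 * (-τ - I)) (fun j => by
      rw [hre]; exact mul_ne_zero (hu0 j) (sub_ne_zero.2 (hτ j)))
    have h2 : (c z0 : ℤ) ≤ c (z0 * (-τ - I)) := by exact_mod_cast h1
    rw [hcard, hcard, ← sub_nonneg, ← Finset.sum_sub_distrib] at h2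
    rw [Finset.sum_filter]
    refine h2.trans_eq (Finset.sum_congr rfl (fun j _ => ?_))
    rw [hre]
    change _ - (if 0 < u j then _ else _) = _
    simp only [hεd]
    rcases lt_or_gt_of_ne (hτ j) with h | h <;> rcases lt_or_gt_of_ne (hu0 j) with h' | h'
    · rw [if_pos (mul_pos_of_neg_of_neg h' (by linarith)), if_neg (by linarith), if_pos h, if_neg (by linarith)]; rfl
    · rw [if_neg (not_lt.2 (mul_neg_of_pos_of_neg h' (by linarith)).le), if_pos h', if_pos h, if_pos h']; rfl
    · rw [if_neg (not_lt.2 (mul_neg_of_neg_of_pos h' (by linarith)).le), if_neg (by linarith), if_neg (by linarith)]; rfl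
    · rw [if_pos (mul_pos h' (by linarith)), if_pos h', if_neg (by linarith)]; rfl
  have hsuf : ∀ τ : ℝ, (∀ i, t i ≠ τ) →
      0 ≤ ∑ i ∈ Finset.univ.filter (fun i => τ < t i), ε i := by
    intro τ hτ
    have hre : ∀ j, (z0 * (τ + I) * d j).re = u j * (τ - t j) := by
      intro j
      rw [mul_right_comm, hw]; simp; ring
    have h1 := hmin (z0 * (τ + I)) (fun j => by
      rw [hre]; exact mul_ne_zero (hu0 j) (sub_ne_zero.2 (hτ j).symm))
    have h2 : (c z0 : ℤ) ≤ c (z0 * (τ + I)) := by exact_mod_cast h1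
    rw [hcard, hcard, ← sub_nonneg, ← Finset.sum_sub_distrib] at h2
    rw [Finset.sum_filter]
    refine h2.trans_eq (Finset.sum_congr rfl (fun j _ => ?_))
    rw [hre]
    change _ - (if 0 < u j then _ else _) = _
    simp only [hεd]
    rcases lt_or_gt_of_ne (hτ j).symm with h | h <;> rcases lt_or_gt_of_ne (hu0 j) with h' | h'
    · rw [if_pos (mul_pos_of_neg_of_neg h' (by linarith)), if_neg (by linarith), if_pos h, if_neg (by linarith)]; rfl
    · rw [if_neg (not_lt.2 (mul_neg_of_pos_of_neg h' (by linarith)).le), if_pos h', if_pos h, if_pos h']; rfl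
    · rw [if_neg (not_lt.2 (mul_neg_of_neg_of_pos h' (by linarith)).le), if_neg (by linarith), if_neg (by linarith)]; rfl
    · rw [if_pos (mul_pos h' (by linarith)), if_pos h', if_neg (by linarith)]; rfl
  obtain ⟨l, hl⟩ := level_fin m ε hε t hte hpre hsuf
  let lev : Fin m → Finset (Fin m) := fun a => Finset.univ.filter (fun i => l i = l a)
  let M : Fin m → Finset (Fin m) := fun a => Finset.univ.filter (fun i => l i = l a ∧ ε i = -1)
  let Pr : Fin m → ℝ := fun j => ∏ i ∈ (lev j).erase j, (t j - t i)
  have hPr : ∀ j, 0 < (ε j : ℝ) * Pr j := fun j => (hl j).1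
  have hcl : ∀ j, (lev j).card = 2 * (M j).card + 1 := fun j => (hl j).2
  have hinj : ∀ a, Set.InjOn t (lev a) := by
    intro a i hi j hj hij
    by_contra hne
    have := hPr i
    have h0 : Pr i = 0 := by
      apply Finset.prod_eq_zero (i := j)
      · simp only [Finset.coe_filter, lev, Set.mem_ofPred_eq, Finset.mem_univ, true_and] at hi hj
        simp [lev, hi, hj, Ne.symm hne]
      · rw [hij]; ring
    rw [h0] at this; simp at this
  let s : Fin m → ℝ := fun j => Real.sqrt (1 / (ε j * Pr j) / |u j|)
  have hspos : ∀ j, 0 < 1 / (ε j * Pr j) / |u j| := fun j =>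
    div_pos (one_div_pos.2 (hPr j)) (abs_pos.2 (hu0 j))
  let Lg : Fin m → Fin m → ℝ := fun a j => ∏ i ∈ (M a).erase a, (t j - t i)
  refine ⟨Finset.univ.filter (fun j => ε j = -1),
    fun a j => if l j = l a then ((Lg a j * s j : ℝ) : ℂ) else 0, ?_, ?_, ?_, ?_⟩
  · have h1 := hC z0 hz00
    have h2 : (Finset.univ.filter (fun j => ε j = -1)) = (Finset.univ.filter (fun j => ¬ (z0 * d j).re < 0)) := by
      ext j; simp only [Finset.mem_filter, Finset.mem_univ, true_and, hεd]
      change _ ↔ ¬ u j < 0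
      rcases lt_or_gt_of_ne (hu0 j) with h' | h'
      · rw [if_neg (by linarith)]; simp [h']
      · rw [if_pos h']; simp [h'.le]
    have h3 := Finset.card_filter_add_card_filter_not (s := (Finset.univ : Finset (Fin m))) (fun j => (z0 * d j).re < 0)
    rw [h2]
    simp at h3 h1 ⊢
    omega
  · intro a ha b hb hba
    simp only [Finset.mem_filter, Finset.mem_univ, true_and] at ha hb
    beta_reduce
    split_ifs with h
    · have : Lg a b = 0 := by
        apply Finset.prod_eq_zero (i := b)
        · simp [M, h, hb, hba]
        · ring
      simp [this]
    · rfl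
  · intro a ha
    beta_reduce
    rw [if_pos rfl]
    norm_cast
    refine mul_ne_zero ?_ (Real.sqrt_pos.2 (hspos a)).ne'
    apply Finset.prod_ne_zero_iff.2
    intro i hi
    simp only [M, Finset.mem_erase, Finset.mem_filter, Finset.mem_univ, true_and] at hi
    rw [sub_ne_zero]
    intro h
    exact hi.1 (hinj a (by simp [lev]) (by simp [lev, hi.2.1]) h).symm
  · intro a ha b hb
    simp only [Finset.mem_filter, Finset.mem_univ, true_and] at ha hb
    beta_reduce
    by_cases hab : l b = l a
    swap
    · apply Finset.sum_eq_zero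
      intro j _
      by_cases h : l j = l a
      · rw [if_neg (show ¬ l j = l b from fun h' => hab (h'.symm.trans h))]; simp
      · rw [if_neg h]; simp
    have hMb : M b = M a := by simp [M, hab]
    apply mul_left_cancel₀ hz00
    rw [mul_zero, Finset.mul_sum]
    let P : Polynomial ℂ := (1 + Polynomial.C I * Polynomial.X) *
      (∏ i ∈ (M a).erase a, (Polynomial.X - Polynomial.C (t i : ℂ))) *
      (∏ i ∈ (M b).erase b, (Polynomial.X - Polynomial.C (t i : ℂ)))
    have hMpos : 0 < (M a).card := Finset.card_pos.2 ⟨a, by simp [M, ha]⟩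
    have hPdeg : P.natDegree ≤ 2 * (M a).card - 1 := by
      have e1 : (1 + Polynomial.C I * Polynomial.X : Polynomial ℂ).natDegree ≤ 1 := by
        compute_degree
      have e2 : (∏ i ∈ (M a).erase a, (Polynomial.X - Polynomial.C (t i : ℂ))).natDegree ≤ (M a).card - 1 := by
        rw [Polynomial.natDegree_finsetProd_X_sub_C_eq_card, Finset.card_erase_of_mem (by simp [M, ha])]
      have e3 : (∏ i ∈ (M b).erase b, (Polynomial.X - Polynomial.C (t i : ℂ))).natDegree ≤ (M a).card - 1 := by
        rw [Polynomial.natDegree_finsetProd_X_sub_C_eq_card, Finset.card_erase_of_mem (by simp [M, hb]), hMb]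
      refine Polynomial.natDegree_mul_le.trans ?_
      have := Polynomial.natDegree_mul_le (p := (1 + Polynomial.C I * Polynomial.X : Polynomial ℂ)) (q := ∏ i ∈ (M a).erase a, (Polynomial.X - Polynomial.C (t i : ℂ)))
      omega
    have hcla := hcl a
    have hlag := Lagrange.coeff_eq_sum (s := lev a) (v := fun i => (t i : ℂ)) (P := P)
      (fun i hi j hj h => hinj a hi hj (Complex.ofReal_injective h))
      (lt_of_le_of_lt Polynomial.degree_le_natDegree (by norm_cast; omega))
    rw [Polynomial.coeff_eq_zero_of_natDegree_lt (by omega)] at hlag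
    have hgoal : ∀ j ∈ lev a, z0 * ((starRingEnd ℂ) (if l j = l a then ((Lg a j * s j : ℝ) : ℂ) else 0) *
        (if l j = l b then ((Lg b j * s j : ℝ) : ℂ) else 0) * d j)
        = -(P.eval (t j : ℂ) / ∏ i ∈ (lev a).erase j, ((t j : ℂ) - t i)) := by
      intro j hj
      have hj' : l j = l a := by simpa [lev] using hj
      have hlevj : lev j = lev a := by simp [lev, hj']
      rw [if_pos hj', if_pos (hj'.trans hab.symm), Complex.conj_ofReal]
      rw [mul_left_comm, hw]
      have hPe : P.eval (t j : ℂ) = (1 + t j * I) * (Lg a j : ℂ) * (Lg b j : ℂ) := by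
        simp [P, Polynomial.eval_prod, Lg, mul_comm I]
      have hprod : ∏ i ∈ (lev a).erase j, ((t j : ℂ) - t i) = ((Pr j : ℝ) : ℂ) := by
        simp [Pr, hlevj]
      rw [hPe, hprod]
      have hss : s j * s j = 1 / (ε j * Pr j) / |u j| := Real.mul_self_sqrt (hspos j).le
      have hfin : s j * s j * u j = - (1 / Pr j) := by
        rw [hss]
        have hP0 : Pr j ≠ 0 := by
          intro h0; have := hPr j; rw [h0] at this; simp at this
        have h0 := hu0 j
        simp only [hεd]
        rcases lt_or_gt_of_ne (hu0 j) with h' | h'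
        · rw [if_neg (by linarith), abs_of_neg h']; push_cast; field_simp
        · rw [if_pos h', abs_of_pos h']; push_cast; field_simp
      have hfc : (s j : ℂ) * s j * u j = - (1 / Pr j) := by exact_mod_cast hfin
      push_cast
      calc _ = ((s j : ℂ) * s j * u j) * ((1 + t j * I) * (Lg a j : ℂ) * (Lg b j : ℂ)) := by ring
        _ = _ := by rw [hfc]; ring
    rw [← Finset.sum_subset (Finset.subset_univ (lev a)), Finset.sum_congr rfl hgoal, Finset.sum_neg_distrib, ← hlag, neg_zero]
    intro j _ hj
    rw [if_neg (by simpa [lev] using hj)]; simp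

lemma ext_neg {E : Type*} [NormedAddCommGroup E] [InnerProductSpace ℂ E] [FiniteDimensional ℂ E]
    (S : E →ₗ[ℂ] E) (hS : ∀ x y, ⟪S x, y⟫_ℂ = ⟪x, S y⟫_ℂ) (U N : Submodule ℂ E) (hN : N ≤ U)
    (hneg : ∀ x ∈ N, x ≠ 0 → (⟪x, S x⟫_ℂ).re < 0) (v : E) (hv : v ∈ U)
    (hvv : ⟪v, S v⟫_ℂ = 0) (hvN : ∀ x ∈ N, ⟪v, S x⟫_ℂ = 0) (y : E) (hy : y ∈ U)
    (hyv : ⟪v, S y⟫_ℂ ≠ 0) :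
    ∃ N2 ≤ U, Module.finrank ℂ N2 = Module.finrank ℂ N + 1 ∧
      ∀ x ∈ N2, x ≠ 0 → (⟪x, S x⟫_ℂ).re < 0 := by
  let C : N →ₗ[ℂ] N := (N.orthogonalProjectionOnto : E →ₗ[ℂ] N) ∘ₗ S ∘ₗ N.subtype
  have hCi : ∀ (x : N) (u : E), ⟪x, N.orthogonalProjectionOnto u⟫_ℂ = ⟪(x : E), u⟫_ℂ := by
    intro x u
    exact Submodule.inner_orthogonalProjectionOnto_eq_of_mem_left x u
  have hinj : Function.Injective C := by
    rw [← LinearMap.ker_eq_bot, LinearMap.ker_eq_bot']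
    intro x hx
    by_contra hne
    have h1 := hneg x x.2 (by simpa using hne)
    have h2 := hCi x (S x)
    have h3 : N.orthogonalProjectionOnto (S x) = 0 := hx
    rw [h3, inner_zero_right] at h2
    rw [← h2] at h1
    simp at h1
  obtain ⟨n0, hn0⟩ := (LinearMap.injective_iff_surjective.mp hinj) (N.orthogonalProjectionOnto (S y))
  have hn0' : ∀ x ∈ N, ⟪x, S (n0 : E)⟫_ℂ = ⟪x, S y⟫_ℂ := by
    intro x hx
    rw [← hCi ⟨x, hx⟩, ← hCi ⟨x, hx⟩, ← hn0]
    rfl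
  set y1 : E := y - n0 with hy1
  have hy1N : ∀ x ∈ N, ⟪x, S y1⟫_ℂ = 0 := by
    intro x hx
    rw [hy1, map_sub, inner_sub_right, hn0' x hx, sub_self]
  set b : ℂ := ⟪v, S y1⟫_ℂ with hb
  have hb0 : b ≠ 0 := by
    rw [hb, hy1, map_sub, inner_sub_right, hvN _ n0.2, sub_zero]
    exact hyv
  have hbc : ⟪y1, S v⟫_ℂ = (starRingEnd ℂ) b := by
    rw [← hS, hb, inner_conj_symm]
  have hbn : 0 < Complex.normSq b := Complex.normSq_pos.mpr hb0
  set r : ℝ := (|(⟪y1, S y1⟫_ℂ).re| + 1) / Complex.normSq b with hr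
  set w : E := y1 - ((r : ℂ) * b) • v with hw
  have hww : (⟪w, S w⟫_ℂ).re < 0 := by
    have h1 : ⟪w, S w⟫_ℂ = ⟪y1, S y1⟫_ℂ - 2 * r * (Complex.normSq b : ℂ) := by
      rw [hw, map_sub, map_smul, inner_sub_left, inner_sub_right, inner_sub_right,
        inner_smul_left, inner_smul_right, inner_smul_left, inner_smul_right, hvv, hbc, ← hb,
        ← Complex.mul_conj b]
      simp
      ring
    have h2 : r * Complex.normSq b = |(⟪y1, S y1⟫_ℂ).re| + 1 := by
      rw [hr]; field_simp
    have h3 : (⟪w, S w⟫_ℂ).re = (⟪y1, S y1⟫_ℂ).re - 2 * (r * Complex.normSq b) := by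
      rw [h1, Complex.sub_re]
      congr 1
      rw [show (2 * (r : ℂ) * (Complex.normSq b : ℂ)) = ((2 * (r * Complex.normSq b) : ℝ) : ℂ) by
        push_cast; ring, Complex.ofReal_re]
    rw [h3, h2]
    have := le_abs_self (⟪y1, S y1⟫_ℂ).re
    have := abs_nonneg (⟪y1, S y1⟫_ℂ).re
    linarith
  have hwN : ∀ x ∈ N, ⟪x, S w⟫_ℂ = 0 := by
    intro x hx
    rw [hw, map_sub, map_smul, inner_sub_right, inner_smul_right, hy1N x hx, ← hS,
      ← inner_conj_symm, hvN x hx]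
    simp
  have hwn : w ∉ N := by
    intro h
    rw [hwN w h] at hww
    simp at hww
  refine ⟨N ⊔ Submodule.span ℂ {w}, ?_, Submodule.finrank_sup_span_singleton hwn, ?_⟩
  · refine sup_le hN ?_
    rw [Submodule.span_singleton_le_iff_mem]
    exact U.sub_mem (U.sub_mem hy (hN n0.2)) (U.smul_mem _ hv)
  · intro x hx hx0
    obtain ⟨a, ha, u, hu, rfl⟩ := Submodule.mem_sup.mp hx
    obtain ⟨c, rfl⟩ := Submodule.mem_span_singleton.mp hu
    have h1 : ⟪a + c • w, S (a + c • w)⟫_ℂ = ⟪a, S a⟫_ℂ + (Complex.normSq c : ℂ) * ⟪w, S w⟫_ℂ := by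
      have : ⟪w, S a⟫_ℂ = 0 := by
        rw [← hS, ← inner_conj_symm, hwN a ha]; simp
      rw [map_add, map_smul, inner_add_left, inner_add_right, inner_add_right, inner_smul_left,
        inner_smul_right, inner_smul_left, inner_smul_right, this, hwN a ha, ← Complex.mul_conj c]
      ring
    rw [h1, Complex.add_re, Complex.re_ofReal_mul]
    by_cases hc : c = 0
    · subst hc
      have := hneg a ha (by simpa using hx0)
      simpa using this
    · have h2 : Complex.normSq c * (⟪w, S w⟫_ℂ).re < 0 :=
        mul_neg_of_pos_of_neg (Complex.normSq_pos.mpr hc) hww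
      by_cases ha0 : a = 0
      · subst ha0; simpa using h2
      · have := hneg a ha ha0
        linarith


lemma ext_negT {E : Type*} [NormedAddCommGroup E] [InnerProductSpace ℂ E] [FiniteDimensional ℂ E]
    (T : E →ₗ[ℂ] E) (z : ℂ) (U N : Submodule ℂ E) (hN : N ≤ U)
    (hneg : ∀ x ∈ N, x ≠ 0 → (z * ⟪x, T x⟫_ℂ).re < 0) (v : E) (hv : v ∈ U)
    (hvv : ⟪v, T v⟫_ℂ = 0) (hvN : ∀ x ∈ N, ⟪v, T x⟫_ℂ = 0 ∧ ⟪T v, x⟫_ℂ = 0) (y : E) (hy : y ∈ U)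
    (hyv : z * ⟪v, T y⟫_ℂ + (starRingEnd ℂ) z * ⟪T v, y⟫_ℂ ≠ 0) :
    ∃ N2 ≤ U, Module.finrank ℂ N2 = Module.finrank ℂ N + 1 ∧
      ∀ x ∈ N2, x ≠ 0 → (z * ⟪x, T x⟫_ℂ).re < 0 := by
  let S : E →ₗ[ℂ] E := z • T + (starRingEnd ℂ) z • LinearMap.adjoint T
  have hSi : ∀ x y, ⟪x, S y⟫_ℂ = z * ⟪x, T y⟫_ℂ + (starRingEnd ℂ) z * ⟪T x, y⟫_ℂ := by
    intro x y
    simp only [S, LinearMap.add_apply, LinearMap.smul_apply, inner_add_right, inner_smul_right,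
      LinearMap.adjoint_inner_right]
  have hSs : ∀ x y, ⟪S x, y⟫_ℂ = ⟪x, S y⟫_ℂ := by
    intro x y
    rw [← inner_conj_symm, hSi, hSi, map_add, map_mul, map_mul, inner_conj_symm, inner_conj_symm]
    simp
    ring
  have hre : ∀ x, (⟪x, S x⟫_ℂ).re = 2 * (z * ⟪x, T x⟫_ℂ).re := by
    intro x
    rw [hSi, ← inner_conj_symm (T x) x, ← map_mul, Complex.add_re, Complex.conj_re]
    ring
  have hvv' : ⟪T v, v⟫_ℂ = 0 := by rw [← inner_conj_symm, hvv]; simp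
  obtain ⟨N2, h1, h2, h3⟩ := ext_neg S hSs U N hN (fun x hx hx0 => by
      rw [hre]; have := hneg x hx hx0; linarith) v hv (by rw [hSi, hvv, hvv']; simp)
      (fun x hx => by rw [hSi, (hvN x hx).1, (hvN x hx).2]; simp) y hy (by rw [hSi]; exact hyv)
  refine ⟨N2, h1, h2, fun x hx hx0 => ?_⟩
  have := h3 x hx hx0
  rw [hre] at this
  linarith

lemma neg_perturb {E : Type*} [NormedAddCommGroup E] [InnerProductSpace ℂ E]
    [FiniteDimensional ℂ E] (T : E →ₗ[ℂ] E) (z : ℂ) (N : Submodule ℂ E)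
    (hneg : ∀ x ∈ N, x ≠ 0 → (z * ⟪x, T x⟫_ℂ).re < 0) :
    ∃ δ : ℝ, 0 < δ ∧ ∀ x ∈ N, x ≠ 0 → (z * (1 + δ * Complex.I) * ⟪x, T x⟫_ℂ).re < 0 := by
  have hTc : Continuous T := T.continuous_of_finiteDimensional
  have hK : IsCompact ((N : Set E) ∩ Metric.sphere (0 : E) 1) := by
    have : ProperSpace E := FiniteDimensional.proper ℂ E
    exact (isCompact_sphere (0 : E) 1).inter_left N.closed_of_finiteDimensional
  have hf : Continuous (fun x : E => (z * ⟪x, T x⟫_ℂ).re) := by fun_prop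
  have hg : Continuous (fun x : E => (z * Complex.I * ⟪x, T x⟫_ℂ).re) := by fun_prop
  rcases ((N : Set E) ∩ Metric.sphere (0 : E) 1).eq_empty_or_nonempty with he | hne
  · refine ⟨1, one_pos, fun x hx hx0 => ?_⟩
    exfalso
    have hm : ((‖x‖⁻¹ : ℝ) : ℂ) • x ∈ ((N : Set E) ∩ Metric.sphere (0 : E) 1) := by
      refine ⟨N.smul_mem _ hx, ?_⟩
      have : ‖x‖ ≠ 0 := norm_ne_zero_iff.mpr hx0
      rw [mem_sphere_zero_iff_norm, norm_smul]
      simp [this]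
    rw [he] at hm
    exact hm
  · obtain ⟨x0, hx0, hmax⟩ := hK.exists_isMaxOn hne hf.continuousOn
    obtain ⟨x1, hx1, hmax1⟩ := hK.exists_isMaxOn hne hg.continuousOn
    have h0 : (z * ⟪x0, T x0⟫_ℂ).re < 0 := by
      apply hneg x0 hx0.1
      rintro rfl
      simp at hx0
    set a := (z * ⟪x0, T x0⟫_ℂ).re
    set M := |(z * Complex.I * ⟪x1, T x1⟫_ℂ).re| with hM
    have hM0 : 0 ≤ M := abs_nonneg _
    have hd : 0 < (-a) / (2 * (M + 1)) := by apply div_pos <;> linarith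
    refine ⟨(-a) / (2 * (M + 1)), hd, fun x hx hx0 => ?_⟩
    set δ := (-a) / (2 * (M + 1)) with hδ
    have hdM : δ * (M + 1) = -a / 2 := by rw [hδ]; field_simp
    have hn : 0 < ‖x‖ := norm_pos_iff.mpr hx0
    set u : E := ((‖x‖⁻¹ : ℝ) : ℂ) • x with hu
    have hm : u ∈ ((N : Set E) ∩ Metric.sphere (0 : E) 1) := by
      refine ⟨N.smul_mem _ hx, ?_⟩
      rw [mem_sphere_zero_iff_norm, hu, norm_smul]
      simp [hn.ne']
    have hxu : x = ((‖x‖ : ℝ) : ℂ) • u := by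
      rw [hu, smul_smul, ← Complex.ofReal_mul, mul_inv_cancel₀ hn.ne']; simp
    have e1 : (z * ⟪u, T u⟫_ℂ).re ≤ a := hmax hm
    have e2 : (z * Complex.I * ⟪u, T u⟫_ℂ).re ≤ M := (hmax1 hm).trans (le_abs_self _)
    have e3 : (z * (1 + δ * Complex.I) * ⟪u, T u⟫_ℂ).re
        = (z * ⟪u, T u⟫_ℂ).re + δ * (z * Complex.I * ⟪u, T u⟫_ℂ).re := by
      rw [← Complex.re_ofReal_mul, ← Complex.add_re]; congr 1; ring
    have e4 : (z * (1 + δ * Complex.I) * ⟪u, T u⟫_ℂ).re < 0 := by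
      rw [e3]
      nlinarith
    have e5 : (z * (1 + δ * Complex.I) * ⟪x, T x⟫_ℂ).re =
        ‖x‖ ^ 2 * (z * (1 + δ * Complex.I) * ⟪u, T u⟫_ℂ).re := by
      have : ⟪x, T x⟫_ℂ = ((‖x‖ ^ 2 : ℝ) : ℂ) * ⟪u, T u⟫_ℂ := by
        conv_lhs => rw [hxu]
        rw [map_smul, inner_smul_left, inner_smul_right]
        simp; ring
      rw [this, ← Complex.re_ofReal_mul]; congr 1; ring
    rw [e5]
    exact mul_neg_of_pos_of_neg (by positivity) e4

def NegOn {E : Type*} [NormedAddCommGroup E] [InnerProductSpace ℂ E] (T : E →ₗ[ℂ] E)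
    (z : ℂ) (N : Submodule ℂ E) : Prop := ∀ x ∈ N, x ≠ 0 → (z * ⟪x, T x⟫_ℂ).re < 0

def IdxC {E : Type*} [NormedAddCommGroup E] [InnerProductSpace ℂ E] (T : E →ₗ[ℂ] E)
    (U : Submodule ℂ E) (k : ℕ) : Prop :=
  ∀ z : ℂ, z ≠ 0 → ∀ N ≤ U, NegOn T z N → Module.finrank ℂ N + k ≤ Module.finrank ℂ U

def Bad {E : Type*} [NormedAddCommGroup E] [InnerProductSpace ℂ E] (T : E →ₗ[ℂ] E)
    (U : Submodule ℂ E) (v : E) : Prop :=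
  v ∈ U ∧ v ≠ 0 ∧ ⟪v, T v⟫_ℂ = 0 ∧ ∃ α β : ℂ, (α ≠ 0 ∨ β ≠ 0) ∧
    ∀ y ∈ U, α * ⟪v, T y⟫_ℂ + β * ⟪T v, y⟫_ℂ = 0

lemma finrank_inf_ker_ge {E : Type*} [NormedAddCommGroup E] [InnerProductSpace ℂ E]
    [FiniteDimensional ℂ E] (U : Submodule ℂ E) (f : E →ₗ[ℂ] ℂ) :
    Module.finrank ℂ U ≤ Module.finrank ℂ (U ⊓ LinearMap.ker f : Submodule ℂ E) + 1 := by
  have h1 := Submodule.finrank_sup_add_finrank_inf_eq U (LinearMap.ker f)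
  have h2 := f.finrank_range_add_finrank_ker
  have h3 : Module.finrank ℂ (LinearMap.range f) ≤ 1 := by
    simpa using (LinearMap.range f).finrank_le
  have h4 := (U ⊔ LinearMap.ker f).finrank_le
  omega

lemma bad_step {E : Type*} [NormedAddCommGroup E] [InnerProductSpace ℂ E] [FiniteDimensional ℂ E]
    (T : E →ₗ[ℂ] E) (U : Submodule ℂ E) (k : ℕ) (v : E) (hbad : Bad T U v)
    (hI : IdxC T U (k + 1)) :
    ∃ W ≤ U, Module.finrank ℂ W < Module.finrank ℂ U ∧ v ∉ W ∧ IdxC T W k ∧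
      ∀ y ∈ W, ⟪v, T y⟫_ℂ = 0 ∧ ⟪T v, y⟫_ℂ = 0 := by
  obtain ⟨hvU, hv0, hvv, α, β, hab, hrel⟩ := hbad
  have hvv' : ⟪T v, v⟫_ℂ = 0 := by rw [← inner_conj_symm, hvv]; simp
  let f1 : E →ₗ[ℂ] ℂ := (innerSL ℂ v : E →L[ℂ] ℂ).toLinearMap ∘ₗ T
  let f2 : E →ₗ[ℂ] ℂ := (innerSL ℂ (T v) : E →L[ℂ] ℂ).toLinearMap
  have hf1 : ∀ y, f1 y = ⟪v, T y⟫_ℂ := fun y => rfl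
  have hf2 : ∀ y, f2 y = ⟪T v, y⟫_ℂ := fun y => rfl
  let W0 : Submodule ℂ E := U ⊓ LinearMap.ker f1 ⊓ LinearMap.ker f2
  have hW0U : W0 ≤ U := inf_le_left.trans inf_le_left
  have hW0m : ∀ y ∈ W0, ⟪v, T y⟫_ℂ = 0 ∧ ⟪T v, y⟫_ℂ = 0 := fun y hy => ⟨hy.1.2, hy.2⟩
  have hW0dim : Module.finrank ℂ U ≤ Module.finrank ℂ W0 + 1 := by
    rcases hab with h | h
    · have : U ⊓ LinearMap.ker f2 ≤ W0 := by
        rintro y ⟨hy, hy2⟩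
        have hy2' : ⟪T v, y⟫_ℂ = 0 := hy2
        refine ⟨⟨hy, ?_⟩, hy2⟩
        have := hrel y hy
        rw [hy2', mul_zero, add_zero, mul_eq_zero] at this
        exact this.resolve_left h
      have h1 := finrank_inf_ker_ge U f2
      have h2 := Submodule.finrank_mono this
      omega
    · have : U ⊓ LinearMap.ker f1 ≤ W0 := by
        rintro y ⟨hy, hy2⟩
        have hy2' : ⟪v, T y⟫_ℂ = 0 := hy2
        refine ⟨⟨hy, hy2⟩, ?_⟩
        have := hrel y hy
        rw [hy2', mul_zero, zero_add, mul_eq_zero] at this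
        exact this.resolve_left h
      have h1 := finrank_inf_ker_ge U f1
      have h2 := Submodule.finrank_mono this
      omega
  have hvW0 : v ∈ W0 := ⟨⟨hvU, hvv⟩, hvv'⟩
  let W : Submodule ℂ E := (Submodule.span ℂ {v})ᗮ ⊓ W0
  have hWd : 1 + Module.finrank ℂ W = Module.finrank ℂ W0 := by
    have := Submodule.finrank_add_inf_finrank_orthogonal
      (K₁ := Submodule.span ℂ {v}) (K₂ := W0) (by
        rw [Submodule.span_singleton_le_iff_mem]; exact hvW0)
    rwa [finrank_span_singleton hv0] at this
  have hWW0 : W ≤ W0 := inf_le_right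
  have hW0le := Submodule.finrank_mono hW0U
  refine ⟨W, hWW0.trans hW0U, by omega, ?_, ?_, fun y hy => hW0m y (hWW0 hy)⟩
  · intro h
    have : ⟪v, v⟫_ℂ = 0 := Submodule.mem_orthogonal_singleton_iff_inner_right.mp h.1
    exact hv0 (inner_self_eq_zero.mp this)
  · intro z hz N hN hneg
    have hNU : N ≤ U := hN.trans (hWW0.trans hW0U)
    have hvN : ∀ x ∈ N, ⟪v, T x⟫_ℂ = 0 ∧ ⟪T v, x⟫_ℂ = 0 := fun x hx => hW0m x (hWW0 (hN hx))
    by_cases hWU : W0 = U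
    · have := hI z hz N hNU hneg
      rw [← hWU] at this
      omega
    · have key : ∀ z' : ℂ, z' ≠ 0 → NegOn T z' N →
          (∃ y ∈ U, z' * ⟪v, T y⟫_ℂ + (starRingEnd ℂ) z' * ⟪T v, y⟫_ℂ ≠ 0) →
          Module.finrank ℂ N + k ≤ Module.finrank ℂ W := by
        rintro z' hz' hneg' ⟨y, hy, hyv⟩
        obtain ⟨N2, h1, h2, h3⟩ := ext_negT T z' U N hNU hneg' v hvU hvv hvN y hy hyv
        have := hI z' hz' N2 h1 h3
        omega
      by_cases hex : ∃ y ∈ U, z * ⟪v, T y⟫_ℂ + (starRingEnd ℂ) z * ⟪T v, y⟫_ℂ ≠ 0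
      · exact key z hz hneg hex
      · push Not at hex
        obtain ⟨δ, hδ, hneg'⟩ := neg_perturb T z N hneg
        have hz1 : (1 + (δ : ℂ) * Complex.I) ≠ 0 := by
          intro h
          have := congrArg Complex.re h
          simp at this
        refine key _ (mul_ne_zero hz hz1) hneg' ?_
        by_contra hcon
        push Not at hcon
        apply hWU
        refine le_antisymm hW0U ?_
        intro y hy
        have e1 := hex y hy
        have e2 := hcon y hy
        simp only [map_mul, map_add, map_one, Complex.conj_ofReal, Complex.conj_I] at e2
        have hd : (δ : ℂ) ≠ 0 := by exact_mod_cast hδ.ne'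
        have hcz : (starRingEnd ℂ) z ≠ 0 := by simpa using hz
        have e3 : (δ : ℂ) * Complex.I * (2 * (z * ⟪v, T y⟫_ℂ)) = 0 := by
          linear_combination e2 - (1 - (δ : ℂ) * Complex.I) * e1
        have e4 : ⟪v, T y⟫_ℂ = 0 := by
          simpa [hd, hz, Complex.I_ne_zero] using e3
        rw [e4] at e1
        have e5 : ⟪T v, y⟫_ℂ = 0 := by simpa [hcz, hz] using e1
        exact ⟨⟨hy, e4⟩, e5⟩

lemma pencil_eig {E : Type*} [NormedAddCommGroup E] [InnerProductSpace ℂ E]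
    [FiniteDimensional ℂ E] (T : E →ₗ[ℂ] E) (U : Submodule ℂ E) (hU : U ≠ ⊥) :
    ∃ v ∈ U, v ≠ 0 ∧ ∃ α β : ℂ, (α ≠ 0 ∨ β ≠ 0) ∧
      ∀ y ∈ U, α * ⟪v, T y⟫_ℂ + β * ⟪T v, y⟫_ℂ = 0 := by
  let M : U →ₗ[ℂ] U := (U.orthogonalProjectionOnto : E →ₗ[ℂ] U) ∘ₗ T ∘ₗ U.subtype
  have hM1 : ∀ x y : U, ⟪x, M y⟫_ℂ = ⟪(x : E), T y⟫_ℂ := by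
    intro x y
    exact Submodule.inner_orthogonalProjectionOnto_eq_of_mem_left x (T y)
  have hM2 : ∀ x y : U, ⟪M x, y⟫_ℂ = ⟪T x, (y : E)⟫_ℂ := by
    intro x y
    rw [← inner_conj_symm, hM1, inner_conj_symm]
  by_cases hinj : Function.Injective M
  · let Me : U ≃ₗ[ℂ] U := LinearEquiv.ofInjectiveEndo M hinj
    have : Nontrivial U := Submodule.nontrivial_iff_ne_bot.mpr hU
    obtain ⟨μ, hμ⟩ := Module.End.exists_eigenvalue
      ((Me.symm.toLinearMap ∘ₗ LinearMap.adjoint M : U →ₗ[ℂ] U) : Module.End ℂ U)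
    obtain ⟨v, hv⟩ := hμ.exists_hasEigenvector
    have h1 : Me.symm (LinearMap.adjoint M v) = μ • v := hv.apply_eq_smul
    have h2 : LinearMap.adjoint M v = μ • M v := by
      have := congrArg Me h1
      rw [LinearEquiv.apply_symm_apply, map_smul] at this
      exact this
    refine ⟨v, v.2, fun h => hv.2 (by simpa using h), 1, -(starRingEnd ℂ) μ, Or.inl one_ne_zero, ?_⟩
    intro y hy
    have h3 : ⟪(v : E), T y⟫_ℂ = (starRingEnd ℂ) μ * ⟪T v, y⟫_ℂ := by
      rw [← hM1 v ⟨y, hy⟩, ← LinearMap.adjoint_inner_left, h2, inner_smul_left, hM2]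
    rw [h3]; ring
  · have : ∃ v : U, v ≠ 0 ∧ M v = 0 := by
      by_contra hcon
      push Not at hcon
      apply hinj
      rw [← LinearMap.ker_eq_bot, LinearMap.ker_eq_bot']
      intro x hx
      by_contra hne
      exact hcon x hne hx
    obtain ⟨v, hv, hMv⟩ := this
    refine ⟨v, v.2, fun h => hv (by simpa using h), 0, 1, Or.inr one_ne_zero, ?_⟩
    intro y hy
    rw [← hM2 v ⟨y, hy⟩, hMv]
    simp

lemma diag_basis {E : Type*} [NormedAddCommGroup E] [InnerProductSpace ℂ E]
    [FiniteDimensional ℂ E] (T : E →ₗ[ℂ] E) : ∀ (m : ℕ) (U : Submodule ℂ E),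
    Module.finrank ℂ U = m → (∀ v, ¬ Bad T U v) →
    ∃ e : Fin m → E, (∀ i, e i ∈ U) ∧ (∀ i j, i ≠ j → ⟪e i, T (e j)⟫_ℂ = 0) ∧
      ∀ i, ⟪e i, T (e i)⟫_ℂ ≠ 0 := by
  intro m
  induction m with
  | zero => intro U _ _; exact ⟨Fin.elim0, fun i => i.elim0, fun i => i.elim0, fun i => i.elim0⟩
  | succ m ih =>
    intro U hUd hnb
    have hU : U ≠ ⊥ := by
      rintro rfl
      simp at hUd
    obtain ⟨v, hvU, hv0, α, β, hab, hrel⟩ := pencil_eig T U hU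
    have hd : ⟪v, T v⟫_ℂ ≠ 0 := fun h => hnb v ⟨hvU, hv0, h, α, β, hab, hrel⟩
    have hd' : ⟪T v, v⟫_ℂ ≠ 0 := by
      rw [← inner_conj_symm]
      exact (map_ne_zero _).mpr hd
    have hv1 := hrel v hvU
    have hβ : β ≠ 0 := by
      rintro rfl
      have : α = 0 := by simpa [hd] using hv1
      simp [this] at hab
    let f1 : E →ₗ[ℂ] ℂ := (innerSL ℂ v : E →L[ℂ] ℂ).toLinearMap ∘ₗ T
    let U1 : Submodule ℂ E := U ⊓ LinearMap.ker f1
    have hU1 : ∀ y ∈ U1, ⟪v, T y⟫_ℂ = 0 ∧ ⟪T v, y⟫_ℂ = 0 := by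
      intro y hy
      have h1 : ⟪v, T y⟫_ℂ = 0 := hy.2
      refine ⟨h1, ?_⟩
      have := hrel y hy.1
      rw [h1] at this
      simpa [hβ] using this
    have hU1U : U1 ≤ U := inf_le_left
    have hvU1 : v ∉ U1 := fun h => hd (hU1 v h).1
    have hfr : Module.finrank ℂ U1 = m := by
      have h1 := finrank_inf_ker_ge U f1
      have h2 := Submodule.finrank_lt_finrank_of_lt (lt_of_le_of_ne hU1U (fun h => hvU1 (h ▸ hvU)))
      change Module.finrank ℂ U ≤ Module.finrank ℂ U1 + 1 at h1
      omega
    obtain ⟨e, he1, he2, he3⟩ := ih U1 hfr (by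
      rintro w ⟨hwU, hw0, hww, a, b, hab', hr⟩
      refine hnb w ⟨hU1U hwU, hw0, hww, a, b, hab', ?_⟩
      intro y hy
      set c := ⟪v, T y⟫_ℂ / ⟪v, T v⟫_ℂ with hc
      have hy1 : y - c • v ∈ U1 := by
        refine ⟨U.sub_mem hy (U.smul_mem _ hvU), ?_⟩
        change ⟪v, T (y - c • v)⟫_ℂ = 0
        rw [map_sub, map_smul, inner_sub_right, inner_smul_right, hc, div_mul_cancel₀ _ hd, sub_self]
      have h1 := hr _ hy1
      have h2 : ⟪w, T v⟫_ℂ = 0 := by rw [← inner_conj_symm, (hU1 w hwU).2]; simp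
      have h3 : ⟪T w, v⟫_ℂ = 0 := by rw [← inner_conj_symm, (hU1 w hwU).1]; simp
      rw [map_sub, map_smul, inner_sub_right, inner_sub_right, inner_smul_right, inner_smul_right,
        h2, h3] at h1
      simpa using h1)
    refine ⟨Fin.cons v e, ?_, ?_, ?_⟩
    · intro i
      refine Fin.cases hvU (fun i => ?_) i
      simpa using hU1U (he1 i)
    · intro i j
      refine Fin.cases ?_ (fun i => ?_) i <;> refine Fin.cases ?_ (fun j => ?_) j
      · intro h; exact absurd rfl h
      · intro _
        simpa using (hU1 _ (he1 j)).1
      · intro _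
        simp only [Fin.cons_succ, Fin.cons_zero]
        rw [← inner_conj_symm, (hU1 _ (he1 i)).2]; simp
      · intro h
        simpa using he2 i j (fun h' => h (by rw [h']))
    · intro i
      refine Fin.cases ?_ (fun i => ?_) i
      · simpa using hd
      · simpa using he3 i

lemma nobad_iso {E : Type*} [NormedAddCommGroup E] [InnerProductSpace ℂ E]
    [FiniteDimensional ℂ E] (T : E →ₗ[ℂ] E) (U : Submodule ℂ E) (k : ℕ)
    (hnb : ∀ v, ¬ Bad T U v) (hI : IdxC T U k) :
    ∃ V ≤ U, Module.finrank ℂ V = k ∧ ∀ x ∈ V, ⟪x, T x⟫_ℂ = 0 := by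
  set m := Module.finrank ℂ U with hm
  obtain ⟨e, heU, heo, hed⟩ := diag_basis T m U rfl hnb
  have hB : ∀ a b : Fin m → ℂ, ⟪∑ j, a j • e j, T (∑ j, b j • e j)⟫_ℂ =
      ∑ j, (starRingEnd ℂ) (a j) * b j * ⟪e j, T (e j)⟫_ℂ := by
    intro a b
    rw [map_sum, sum_inner]
    refine Finset.sum_congr rfl (fun i _ => ?_)
    rw [inner_sum, Finset.sum_eq_single i]
    · rw [map_smul, inner_smul_left, inner_smul_right]; ring
    · intro j _ hj
      rw [map_smul, inner_smul_left, inner_smul_right, heo i j (Ne.symm hj)]; ring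
    · simp
  have hei : ∀ i (b : Fin m → ℂ), ⟪e i, T (∑ j, b j • e j)⟫_ℂ = b i * ⟪e i, T (e i)⟫_ℂ := by
    intro i b
    rw [map_sum, inner_sum, Finset.sum_eq_single i]
    · rw [map_smul, inner_smul_right]
    · intro j _ hj
      rw [map_smul, inner_smul_right, heo i j (Ne.symm hj), mul_zero]
    · simp
  have hli : LinearIndependent ℂ e := by
    rw [Fintype.linearIndependent_iff]
    intro g hg i
    have := hei i g
    rw [hg, map_zero, inner_zero_right] at this
    simpa [hed i] using this.symm
  have hspan : Submodule.span ℂ (Set.range e) = U := by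
    apply Submodule.eq_of_le_of_finrank_eq
    · rw [Submodule.span_le]; rintro _ ⟨i, rfl⟩; exact heU i
    · rw [finrank_span_eq_card hli]; simp [hm]
  obtain ⟨J, x, hJ, hx1, hx2, hx3⟩ := diag_iso m k (fun j => ⟪e j, T (e j)⟫_ℂ) hed (by
      intro i j s hs h
      have hij : i ≠ j := by
        rintro rfl
        have h1 : (1 + (s : ℂ)) * ⟪e i, T (e i)⟫_ℂ = 0 := by linear_combination h
        have h2 : (1 + (s : ℂ)) ≠ 0 := by
          intro h3
          have := congrArg Complex.re h3
          simp at this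
          linarith
        exact (mul_ne_zero h2 (hed i)) h1
      set c : ℂ := ((Real.sqrt s : ℝ) : ℂ) with hc
      have hcc : c * c = s := by
        rw [hc, ← Complex.ofReal_mul, Real.mul_self_sqrt hs.le]
      have hcj : (starRingEnd ℂ) c = c := by rw [hc, Complex.conj_ofReal]
      set v : E := e i + c • e j with hv
      have hvl : ∀ l, ⟪v, T (e l)⟫_ℂ = ⟪e i, T (e l)⟫_ℂ + c * ⟪e j, T (e l)⟫_ℂ := by
        intro l; rw [hv, inner_add_left, inner_smul_left, hcj]
      have hvl' : ∀ l, ⟪e l, T v⟫_ℂ = ⟪e l, T (e i)⟫_ℂ + c * ⟪e l, T (e j)⟫_ℂ := by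
        intro l; rw [hv, map_add, map_smul, inner_add_right, inner_smul_right]
      have hvv : ⟪v, T v⟫_ℂ = 0 := by
        conv_lhs => rw [hv]
        rw [inner_add_left, inner_smul_left, hcj, hvl', hvl', heo i j hij, heo j i hij.symm, h]
        linear_combination ⟪e j, T (e j)⟫_ℂ * hcc
      refine hnb v ⟨?_, ?_, hvv, (starRingEnd ℂ) ⟪e j, T (e j)⟫_ℂ, - ⟪e j, T (e j)⟫_ℂ,
        Or.inr (neg_ne_zero.mpr (hed j)), ?_⟩
      · exact U.add_mem (heU i) (U.smul_mem _ (heU j))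
      · intro h0
        have := hvl' i
        rw [h0, map_zero, inner_zero_right, heo i j hij] at this
        exact hed i (by simpa using this.symm)
      · let f : E →ₗ[ℂ] ℂ := (starRingEnd ℂ) ⟪e j, T (e j)⟫_ℂ •
          ((innerSL ℂ v : E →L[ℂ] ℂ).toLinearMap ∘ₗ T) +
            (- ⟪e j, T (e j)⟫_ℂ) • (innerSL ℂ (T v) : E →L[ℂ] ℂ).toLinearMap
        have hf : U ≤ LinearMap.ker f := by
          rw [← hspan, Submodule.span_le]
          rintro _ ⟨l, rfl⟩
          change (starRingEnd ℂ) ⟪e j, T (e j)⟫_ℂ * ⟪v, T (e l)⟫_ℂ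
            + (- ⟪e j, T (e j)⟫_ℂ) * ⟪T v, e l⟫_ℂ = 0
          rw [← inner_conj_symm (T v), hvl, hvl']
          by_cases hli : l = i
          · subst hli
            rw [heo j l hij.symm, heo l j hij, h]
            simp; ring
          · by_cases hlj : l = j
            · subst hlj
              rw [heo i l hij, heo l i hij.symm]
              simp [hcj]; ring
            · rw [heo i l (Ne.symm hli), heo j l (Ne.symm hlj), heo l i hli, heo l j hlj]
              simp
        intro y hy
        exact hf hy) (by
      intro z hz
      set F := Finset.univ.filter (fun j => (z * ⟪e j, T (e j)⟫_ℂ).re < 0) with hF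
      have hmem : ∀ j, j ∈ F ↔ (z * ⟪e j, T (e j)⟫_ℂ).re < 0 := by intro j; simp [hF]
      have hfr : Module.finrank ℂ (Submodule.span ℂ (Set.range (fun j : F => e j))) = F.card := by
        exact (finrank_span_eq_card (hli.comp (fun j : F => (j : Fin m)) Subtype.val_injective)).trans (by simp)
      have := hI z hz (Submodule.span ℂ (Set.range (fun j : F => e j))) (by
        rw [Submodule.span_le]; rintro _ ⟨i, rfl⟩; exact heU i) (by
        intro y hy hy0
        obtain ⟨c, rfl⟩ := (Submodule.mem_span_range_iff_exists_fun ℂ).mp hy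
        let c' : Fin m → ℂ := fun j => if h : j ∈ F then c ⟨j, h⟩ else 0
        have hcc : ∑ j : F, c j • e j = ∑ j, c' j • e j := by
          rw [← Finset.sum_subset (Finset.subset_univ F), ← Finset.sum_coe_sort F]
          · refine Finset.sum_congr rfl (fun j _ => ?_)
            simp [c']
          · intro j _ hj
            simp [c', hj]
        rw [hcc] at hy0 ⊢
        rw [hB, Finset.mul_sum, Complex.re_sum]
        have hterm : ∀ j, (z * ((starRingEnd ℂ) (c' j) * c' j * ⟪e j, T (e j)⟫_ℂ)).re =
            Complex.normSq (c' j) * (z * ⟪e j, T (e j)⟫_ℂ).re := by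
          intro j
          rw [← Complex.re_ofReal_mul, ← Complex.mul_conj]; congr 1; ring
        simp only [hterm]
        have hle : ∀ j, Complex.normSq (c' j) * (z * ⟪e j, T (e j)⟫_ℂ).re ≤ 0 := by
          intro j
          by_cases hj : j ∈ F
          · exact mul_nonpos_of_nonneg_of_nonpos (Complex.normSq_nonneg _) ((hmem j).mp hj).le
          · simp [c', hj]
        have hex : ∃ j, c' j ≠ 0 := by
          by_contra hcon
          push Not at hcon
          apply hy0
          simp [hcon]
        obtain ⟨j, hj⟩ := hex
        have hjF : j ∈ F := by
          by_contra hjF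
          simp [c', hjF] at hj
        have h0 : (∑ j : Fin m, (0 : ℝ)) = 0 := by simp
        rw [← h0]
        refine Finset.sum_lt_sum (fun j _ => hle j) ⟨j, Finset.mem_univ _, ?_⟩
        exact mul_neg_of_pos_of_neg (Complex.normSq_pos.mpr hj) ((hmem j).mp hjF))
      rw [hfr] at this
      exact this)
  obtain ⟨J', hJ'J, hJ'c⟩ := Finset.exists_subset_card_eq hJ
  let w : J' → E := fun a => ∑ j, x a j • e j
  have hcomb : ∀ g : J' → ℂ, ∑ a, g a • w a = ∑ j, (∑ a : J', g a * x a j) • e j := by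
    intro g
    simp only [w, Finset.smul_sum, Finset.sum_smul, smul_smul]
    rw [Finset.sum_comm]
  have hwli : LinearIndependent ℂ w := by
    rw [Fintype.linearIndependent_iff]
    intro g hg a
    rw [hcomb] at hg
    have h1 := (Fintype.linearIndependent_iff.mp hli) _ hg a
    rw [Finset.sum_eq_single a] at h1
    · simpa [hx2 a (hJ'J a.2)] using h1
    · intro b _ hb
      rw [hx1 b (hJ'J b.2) a (hJ'J a.2) (fun h => hb (Subtype.ext h.symm)), mul_zero]
    · simp
  refine ⟨Submodule.span ℂ (Set.range w), ?_, ?_, ?_⟩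
  · rw [Submodule.span_le]
    rintro _ ⟨a, rfl⟩
    exact U.sum_mem (fun j _ => U.smul_mem _ (heU j))
  · rw [finrank_span_eq_card hwli]; simp [hJ'c]
  · intro y hy
    obtain ⟨g, rfl⟩ := (Submodule.mem_span_range_iff_exists_fun ℂ).mp hy
    rw [map_sum, sum_inner]
    refine Finset.sum_eq_zero (fun a _ => ?_)
    rw [inner_sum]
    refine Finset.sum_eq_zero (fun b _ => ?_)
    rw [map_smul, inner_smul_left, inner_smul_right, hB, hx3 a (hJ'J a.2) b (hJ'J b.2)]
    simp

theorem iso_main {E : Type*} [NormedAddCommGroup E] [InnerProductSpace ℂ E]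
    [FiniteDimensional ℂ E] (T : E →ₗ[ℂ] E) : ∀ (n : ℕ) (U : Submodule ℂ E) (k : ℕ),
    Module.finrank ℂ U ≤ n → IdxC T U k →
    ∃ V ≤ U, Module.finrank ℂ V = k ∧ ∀ x ∈ V, ⟪x, T x⟫_ℂ = 0 := by
  intro n
  induction n with
  | zero =>
    intro U k hU hI
    have h := hI 1 one_ne_zero ⊥ bot_le (by
      intro x hx hx0; exact absurd ((Submodule.mem_bot ℂ).mp hx) hx0)
    have hk : k = 0 := by omega
    subst hk
    exact ⟨⊥, bot_le, by simp, fun x hx => by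
      rw [(Submodule.mem_bot ℂ).mp hx]; simp⟩
  | succ n ih =>
    intro U k hU hI
    by_cases hb : ∃ v, Bad T U v
    · obtain ⟨v, hv⟩ := hb
      cases k with
      | zero =>
        exact ⟨⊥, bot_le, by simp, fun x hx => by
          rw [(Submodule.mem_bot ℂ).mp hx]; simp⟩
      | succ k =>
        obtain ⟨W, hWU, hWd, hvW, hWI, hWv⟩ := bad_step T U k v hv hI
        obtain ⟨V, hVW, hVk, hV⟩ := ih W k (by omega) hWI
        refine ⟨V ⊔ Submodule.span ℂ {v}, ?_, ?_, ?_⟩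
        · refine sup_le (hVW.trans hWU) ?_
          rw [Submodule.span_singleton_le_iff_mem]
          exact hv.1
        · rw [Submodule.finrank_sup_span_singleton (fun h => hvW (hVW h)), hVk]
        · intro x hx
          obtain ⟨a, ha, u, hu, rfl⟩ := Submodule.mem_sup.mp hx
          obtain ⟨c, rfl⟩ := Submodule.mem_span_singleton.mp hu
          have h1 : ⟪a, T v⟫_ℂ = 0 := by
            rw [← inner_conj_symm, (hWv a (hVW ha)).2]; simp
          rw [map_add, map_smul, inner_add_left, inner_add_right, inner_add_right,
            inner_smul_left, inner_smul_right, inner_smul_left, inner_smul_right, hV a ha, h1,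
            (hWv a (hVW ha)).1, hv.2.2.1]
          simp
    · push Not at hb
      exact nobad_iso T U k hb hI

lemma exists_angle (w : ℂ) (hw : ‖w‖ = 1) :
    ∃ ξ ∈ Set.Ico (0 : ℝ) (2 * Real.pi), Complex.exp (ξ * Complex.I) = w := by
  have h1 : Complex.exp (Complex.arg w * Complex.I) = w := by
    have := Complex.norm_mul_exp_arg_mul_I w
    rwa [hw, Complex.ofReal_one, one_mul] at this
  by_cases h : 0 ≤ Complex.arg w
  · exact ⟨Complex.arg w, ⟨h, by have := Complex.arg_le_pi w; have := Real.pi_pos; linarith⟩, h1⟩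
  · push Not at h
    refine ⟨Complex.arg w + 2 * Real.pi, ⟨by have := Complex.neg_pi_lt_arg w; linarith,
      by linarith⟩, ?_⟩
    have h2 : ((Complex.arg w + 2 * Real.pi : ℝ) : ℂ) * Complex.I =
        Complex.arg w * Complex.I + 2 * Real.pi * Complex.I := by push_cast; ring
    rw [h2, Complex.exp_periodic, h1]

lemma orthProj_star {E : Type*} [NormedAddCommGroup E] [InnerProductSpace ℂ E]
    [CompleteSpace E] [FiniteDimensional ℂ E] (V : Submodule ℂ E) :
    IsOrthProj V.starProjection ∧ opRank V.starProjection = (Module.finrank ℂ V : Cardinal) := by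
  refine ⟨⟨isSelfAdjoint_starProjection V, ?_⟩, ?_⟩
  · ext1 x
    exact Submodule.starProjection_eq_self_iff.mpr (Submodule.starProjection_apply_mem V x)
  · unfold opRank
    have : LinearMap.range (V.starProjection : E →ₗ[ℂ] E) = V := by
      exact Submodule.range_starProjection V
    rw [this, Module.finrank_eq_rank]

lemma idx_of_mem {E : Type*} [NormedAddCommGroup E] [InnerProductSpace ℂ E]
    [CompleteSpace E] [FiniteDimensional ℂ E] (n k : ℕ) (hn : Module.finrank ℂ E = n)
    (hk2 : 1 ≤ k) (hk : k ≤ n) (A : E →L[ℂ] E) (μ : ℂ)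
    (h : ∀ ξ ∈ Set.Ico (0 : ℝ) (2 * Real.pi), ∀ P : E →L[ℂ] E, IsOrthProj P →
      opRank P = ((k - 1 : ℕ) : Cardinal) →
      μ ∈ numRange (A + (2 * Complex.exp (ξ * Complex.I) * (‖A‖ : ℂ)) • P)) :
    IdxC ((A : E →ₗ[ℂ] E) - μ • LinearMap.id) ⊤ k := by
  intro z hz N _ hneg
  rw [finrank_top, hn]
  have hz0 : 0 < ‖z‖ := norm_pos_iff.mpr hz
  set u : ℂ := z / (‖z‖ : ℂ) with hu
  have hzu : z = (‖z‖ : ℂ) * u := by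
    have : (‖z‖ : ℂ) ≠ 0 := by exact_mod_cast hz0.ne'
    rw [hu, mul_div_cancel₀ _ this]
  have hun : ‖u‖ = 1 := by rw [hu, norm_div]; simp [hz0.ne']
  have huu : u * (starRingEnd ℂ) u = 1 := by
    rw [Complex.mul_conj, Complex.normSq_eq_norm_sq, hun]; simp
  obtain ⟨ξ, hξ, hξe⟩ := exists_angle (-(starRingEnd ℂ) u) (by simp [hun])
  let T : E →ₗ[ℂ] E := A
  let S : E →ₗ[ℂ] E := u • T + (starRingEnd ℂ) u • LinearMap.adjoint T
  have hSi : ∀ x y, ⟪x, S y⟫_ℂ = u * ⟪x, A y⟫_ℂ + (starRingEnd ℂ) u * ⟪A x, y⟫_ℂ := by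
    intro x y
    simp only [S, LinearMap.add_apply, LinearMap.smul_apply, inner_add_right, inner_smul_right,
      LinearMap.adjoint_inner_right]
    rfl
  have hSs : S.IsSymmetric := by
    intro x y
    rw [← inner_conj_symm, hSi, hSi, map_add, map_mul, map_mul, inner_conj_symm, inner_conj_symm]
    simp
    ring
  have hre : ∀ x, (⟪x, S x⟫_ℂ).re = 2 * (u * ⟪x, A x⟫_ℂ).re := by
    intro x
    rw [hSi, ← inner_conj_symm (A x) x, ← map_mul, Complex.add_re, Complex.conj_re]
    ring
  let b := hSs.eigenvectorBasis hn
  let l := hSs.eigenvalues hn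
  have hb : ∀ i, S (b i) = (l i : ℂ) • b i := fun i => hSs.apply_eigenvectorBasis hn i
  have hbS : ∀ i x, ⟪b i, S x⟫_ℂ = l i * ⟪b i, x⟫_ℂ := by
    intro i x
    rw [← hSs, hb, inner_smul_left]; simp
  have hquad : ∀ x, (⟪x, S x⟫_ℂ).re = ∑ i, l i * ‖⟪b i, x⟫_ℂ‖ ^ 2 := by
    intro x
    rw [← b.sum_inner_mul_inner, Complex.re_sum]
    refine Finset.sum_congr rfl (fun i _ => ?_)
    rw [hbS, ← inner_conj_symm, ← Complex.normSq_eq_norm_sq,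
      show (starRingEnd ℂ) ⟪b i, x⟫_ℂ * (l i * ⟪b i, x⟫_ℂ) =
        ((l i * Complex.normSq ⟪b i, x⟫_ℂ : ℝ) : ℂ) by
        rw [Complex.ofReal_mul, ← Complex.mul_conj]; ring, Complex.ofReal_re]
  have hnorm : ∀ x, ‖x‖ ^ 2 = ∑ i, ‖⟪b i, x⟫_ℂ‖ ^ 2 := fun x => (b.sum_sq_norm_inner_right x).symm
  have hlb : ∀ i, |l i| ≤ 2 * ‖A‖ := by
    intro i
    have h1 : (⟪b i, S (b i)⟫_ℂ).re = l i := by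
      rw [hbS, inner_self_eq_norm_sq_to_K, b.norm_eq_one]; simp
    rw [← h1, hre, abs_mul, abs_two]
    have h2 : |(u * ⟪b i, A (b i)⟫_ℂ).re| ≤ ‖A‖ := by
      refine (Complex.abs_re_le_norm _).trans ?_
      rw [norm_mul, hun, one_mul]
      refine (norm_inner_le_norm _ _).trans ?_
      rw [b.norm_eq_one, one_mul]
      have := A.le_opNorm (b i)
      rwa [b.norm_eq_one, mul_one] at this
    linarith
  set m : ℝ := 2 * (u * μ).re with hm
  let G : Finset (Fin n) := Finset.univ.filter (fun i => m ≤ l i)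
  have hG : ∀ i, i ∈ G ↔ m ≤ l i := by intro i; simp [G]
  -- projections on coordinate subspaces
  have hcoord : ∀ J : Finset (Fin n), ∀ i, i ∉ J →
      ∀ x ∈ Submodule.span ℂ (Set.range (fun j : J => b j)), ⟪b i, x⟫_ℂ = 0 := by
    intro J i hi x hx
    have : Submodule.span ℂ (Set.range (fun j : J => b j)) ≤
        LinearMap.ker (innerSL ℂ (b i) : E →L[ℂ] ℂ).toLinearMap := by
      rw [Submodule.span_le]
      rintro _ ⟨j, rfl⟩
      change ⟪b i, b j⟫_ℂ = 0
      exact b.orthonormal.2 (fun h => hi (h ▸ j.2))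
    exact this hx
  have hfr : ∀ J : Finset (Fin n),
      Module.finrank ℂ (Submodule.span ℂ (Set.range (fun j : J => b j))) = J.card := by
    intro J
    exact (finrank_span_eq_card (b.orthonormal.linearIndependent.comp
      (fun j : J => (j : Fin n)) Subtype.val_injective)).trans (by simp)
  have hGk : k ≤ G.card := by
    by_contra hlt
    push Not at hlt
    obtain ⟨J, hGJ, hJ⟩ := Finset.exists_superset_card_eq (s := G) (n := k - 1) (by omega)
      (by simp; omega)
    set V := Submodule.span ℂ (Set.range (fun j : J => b j)) with hV
    obtain ⟨x, hx1, hx⟩ := h ξ hξ V.starProjection (orthProj_star V).1 (by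
      rw [(orthProj_star V).2, hfr, hJ])
    have hPb : ∀ i, ⟪b i, V.starProjection x⟫_ℂ = if i ∈ J then ⟪b i, x⟫_ℂ else 0 := by
      intro i
      split_ifs with hi
      · rw [← Submodule.inner_starProjection_left_eq_right,
          Submodule.starProjection_eq_self_iff.mpr]
        exact Submodule.subset_span ⟨⟨i, hi⟩, rfl⟩
      · exact hcoord J i hi _ (Submodule.starProjection_apply_mem V x)
    have hP : (⟪x, V.starProjection x⟫_ℂ).re = ∑ i, (if i ∈ J then ‖⟪b i, x⟫_ℂ‖ ^ 2 else 0) := by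
      rw [← b.sum_inner_mul_inner, Complex.re_sum]
      refine Finset.sum_congr rfl (fun i _ => ?_)
      rw [hPb]
      split_ifs
      · rw [← inner_conj_symm, mul_comm, Complex.mul_conj, Complex.ofReal_re,
          Complex.normSq_eq_norm_sq]
      · simp
    have hmx : m = (⟪x, S x⟫_ℂ).re - 4 * ‖A‖ * (⟪x, V.starProjection x⟫_ℂ).re := by
      rw [hre, hm, ← hx, add_apply, smul_apply,
        inner_add_right, inner_smul_right, hξe,
        show u * (⟪x, A x⟫_ℂ + 2 * -(starRingEnd ℂ) u * ‖A‖ * ⟪x, V.starProjection x⟫_ℂ) =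
          u * ⟪x, A x⟫_ℂ - ((2 * ‖A‖ : ℝ) : ℂ) * ⟪x, V.starProjection x⟫_ℂ by
          push_cast
          linear_combination (-2 * ‖A‖ * ⟪x, V.starProjection x⟫_ℂ) * huu,
        Complex.sub_re, Complex.re_ofReal_mul]
      ring
    have hnJ : ∃ i', i' ∉ J := by
      by_contra hcon
      push Not at hcon
      have : J = Finset.univ := Finset.eq_univ_iff_forall.mpr hcon
      rw [this] at hJ
      simp at hJ
      omega
    obtain ⟨i', hi'⟩ := hnJ
    have hlm : ∀ i, i ∉ J → l i < m := by
      intro i hi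
      by_contra hc
      push Not at hc
      exact hi (hGJ ((hG i).mpr hc))
    have hcoef : ∀ i, l i - (if i ∈ J then 4 * ‖A‖ else 0) < m := by
      intro i
      split_ifs with hi
      · have h1 := abs_le.mp (hlb i)
        have h2 := abs_le.mp (hlb i')
        have h3 := hlm i' hi'
        linarith
      · have := hlm i hi; linarith
    have hsum : ∑ i, ‖⟪b i, x⟫_ℂ‖ ^ 2 = 1 := by rw [← hnorm, hx1]; simp
    have hmx' : m = ∑ i, (l i - (if i ∈ J then 4 * ‖A‖ else 0)) * ‖⟪b i, x⟫_ℂ‖ ^ 2 := by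
      rw [hmx, hquad, hP, Finset.mul_sum, ← Finset.sum_sub_distrib]
      refine Finset.sum_congr rfl (fun i _ => ?_)
      split_ifs <;> ring
    have hmm : m = ∑ i, m * ‖⟪b i, x⟫_ℂ‖ ^ 2 := by rw [← Finset.mul_sum, hsum, mul_one]
    have hex : ∃ i, ‖⟪b i, x⟫_ℂ‖ ^ 2 ≠ 0 := by
      by_contra hcon
      push Not at hcon
      simp only [hcon] at hsum
      simp at hsum
    obtain ⟨i, hi⟩ := hex
    have hlt : ∑ i, (l i - (if i ∈ J then 4 * ‖A‖ else 0)) * ‖⟪b i, x⟫_ℂ‖ ^ 2 <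
        ∑ i, m * ‖⟪b i, x⟫_ℂ‖ ^ 2 := by
      refine Finset.sum_lt_sum (fun j _ => mul_le_mul_of_nonneg_right (hcoef j).le (sq_nonneg _))
        ⟨i, Finset.mem_univ _, ?_⟩
      exact mul_lt_mul_of_pos_right (hcoef i) (lt_of_le_of_ne (sq_nonneg _) (Ne.symm hi))
    rw [← hmx', ← hmm] at hlt
    exact lt_irrefl _ hlt
  set K := Submodule.span ℂ (Set.range (fun j : G => b j)) with hK
  have hdisj : Disjoint N K := by
    rw [Submodule.disjoint_def]
    intro x hxN hxK
    by_contra hx0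
    have h1 := hneg x hxN hx0
    have h2 : z * ⟪x, ((A : E →ₗ[ℂ] E) - μ • LinearMap.id : E →ₗ[ℂ] E) x⟫_ℂ =
        (‖z‖ : ℂ) * (u * ⟪x, A x⟫_ℂ - ((‖x‖ ^ 2 : ℝ) : ℂ) * (u * μ)) := by
      have : ((A : E →ₗ[ℂ] E) - μ • LinearMap.id : E →ₗ[ℂ] E) x = A x - μ • x := rfl
      rw [this, inner_sub_right, inner_smul_right, inner_self_eq_norm_sq_to_K]
      conv_lhs => rw [hzu]
      push_cast
      simp only [Complex.coe_algebraMap]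
      ring
    rw [h2, Complex.re_ofReal_mul, Complex.sub_re, Complex.re_ofReal_mul] at h1
    have h3 : (u * ⟪x, A x⟫_ℂ).re - ‖x‖ ^ 2 * (u * μ).re < 0 := by
      by_contra hc
      push Not at hc
      exact absurd h1 (not_lt.mpr (mul_nonneg hz0.le hc))
    have h4 : m * ‖x‖ ^ 2 ≤ (⟪x, S x⟫_ℂ).re := by
      rw [hquad, hnorm, Finset.mul_sum]
      refine Finset.sum_le_sum (fun i _ => ?_)
      by_cases hi : i ∈ G
      · exact mul_le_mul_of_nonneg_right ((hG i).mp hi) (sq_nonneg _)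
      · rw [hcoord G i hi x hxK]; simp
    rw [hre, hm] at h4
    linarith
  have := Submodule.finrank_add_finrank_le_of_disjoint hdisj
  rw [hfr, hn] at this
  omega

lemma polar_zero {E : Type*} [NormedAddCommGroup E] [InnerProductSpace ℂ E]
    (T : E →ₗ[ℂ] E) (V : Submodule ℂ E) (hV : ∀ x ∈ V, ⟪x, T x⟫_ℂ = 0) :
    ∀ x ∈ V, ∀ y ∈ V, ⟪x, T y⟫_ℂ = 0 := by
  intro x hx y hy
  have h1 := hV (x + y) (V.add_mem hx hy)
  have h2 := hV (x + Complex.I • y) (V.add_mem hx (V.smul_mem _ hy))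
  rw [map_add, inner_add_left, inner_add_right, inner_add_right, hV x hx, hV y hy] at h1
  rw [map_add, map_smul, inner_add_left, inner_add_right, inner_add_right, inner_smul_left,
    inner_smul_right, inner_smul_left, inner_smul_right, hV x hx, hV y hy] at h2
  simp only [Complex.conj_I] at h2
  have h3 : Complex.I * (2 * ⟪x, T y⟫_ℂ) = 0 := by
    linear_combination h2 + Complex.I * h1
  simpa [Complex.I_ne_zero] using h3

theorem rankKRange_eq_iInter_numRange_finiteDim
    (n k : ℕ) (hk2 : 2 ≤ k) (hk : k ≤ n)
    (A : EuclideanSpace ℂ (Fin n) →L[ℂ] EuclideanSpace ℂ (Fin n)) :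
    rankKRange k A =
      ⋂ ξ ∈ Set.Ico (0 : ℝ) (2 * Real.pi),
        ⋂ P ∈ {P : EuclideanSpace ℂ (Fin n) →L[ℂ] EuclideanSpace ℂ (Fin n) |
            IsOrthProj P ∧ opRank P = ((k - 1 : ℕ) : Cardinal)},
          numRange (A + (2 * Complex.exp (ξ * Complex.I) * (‖A‖ : ℂ)) • P) := by
  apply Set.Subset.antisymm
  · rintro μ ⟨P, ⟨hPs, hPi⟩, hPr, hPA⟩
    simp only [Set.mem_iInter]
    rintro ξ _ Q ⟨_, hQr⟩
    have hP1 : Module.finrank ℂ (LinearMap.range (P : EuclideanSpace ℂ (Fin n) →ₗ[ℂ] EuclideanSpace ℂ (Fin n))) = k :=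
      Module.finrank_eq_of_rank_eq hPr
    have hQ1 : Module.finrank ℂ (LinearMap.range (Q : EuclideanSpace ℂ (Fin n) →ₗ[ℂ] EuclideanSpace ℂ (Fin n))) = k - 1 :=
      Module.finrank_eq_of_rank_eq hQr
    have hQ2 := (Q : EuclideanSpace ℂ (Fin n) →ₗ[ℂ] EuclideanSpace ℂ (Fin n)).finrank_range_add_finrank_ker
    have hnd : ¬ Disjoint (LinearMap.range (P : EuclideanSpace ℂ (Fin n) →ₗ[ℂ] EuclideanSpace ℂ (Fin n)))
        (LinearMap.ker (Q : EuclideanSpace ℂ (Fin n) →ₗ[ℂ] EuclideanSpace ℂ (Fin n))) := by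
      intro hd
      have := Submodule.finrank_add_finrank_le_of_disjoint hd
      omega
    rw [Submodule.disjoint_def] at hnd
    push Not at hnd
    obtain ⟨x, hxP, hxQ, hx0⟩ := hnd
    have hPx : P x = x := by
      obtain ⟨y, rfl⟩ := hxP
      exact congrArg (fun F => F y) hPi
    have hQx : Q x = 0 := hxQ
    have hxn : ‖x‖ ≠ 0 := norm_ne_zero_iff.mpr hx0
    have hAx : ⟪x, A x⟫_ℂ = μ * ⟪x, x⟫_ℂ := by
      have h1 : P (A (P x)) = μ • P x := congrArg (fun F => F x) hPA
      rw [hPx] at h1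
      have h2 : ⟪P x, A x⟫_ℂ = ⟪x, P (A x)⟫_ℂ := by
        rw [← ContinuousLinearMap.adjoint_inner_right]
        rw [hPs.adjoint_eq]
      rw [hPx, h1, inner_smul_right] at h2
      exact h2
    refine ⟨((‖x‖⁻¹ : ℝ) : ℂ) • x, ?_, ?_⟩
    · rw [norm_smul]; simp [hxn]
    · rw [map_smul, add_apply, smul_apply, hQx, smul_zero,
        add_zero, inner_smul_left, inner_smul_right, hAx, inner_self_eq_norm_sq_to_K]
      have : (‖x‖ : ℂ) ≠ 0 := by exact_mod_cast hxn
      simp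
      field_simp
  · intro μ hμ
    simp only [Set.mem_iInter] at hμ
    have hI := idx_of_mem n k (by simp) (by omega) hk A μ
      (fun ξ hξ P h1 h2 => hμ ξ hξ P ⟨h1, h2⟩)
    obtain ⟨V, -, hVk, hV⟩ := iso_main _ _ ⊤ k le_rfl hI
    have hpol := polar_zero _ V hV
    refine ⟨V.starProjection, (orthProj_star V).1, by rw [(orthProj_star V).2, hVk], ?_⟩
    ext1 x
    have hmem := Submodule.starProjection_apply_mem V
    have key : V.starProjection (A (V.starProjection x)) = μ • V.starProjection x := by
      have h0 : V.starProjection (A (V.starProjection x) - μ • V.starProjection x) = 0 := by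
        rw [Submodule.starProjection_apply_eq_zero_iff, Submodule.mem_orthogonal]
        intro y hy
        exact hpol y hy _ (hmem x)
      rw [map_sub, map_smul, Submodule.starProjection_eq_self_iff.mpr (hmem x)] at h0
      exact sub_eq_zero.mp h0
    exact key
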